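/- Klainerman–Sobolev inequality on truncated hyperboloids: There is a constant C > 0 such that for every ρ ≥ 2 and every C² function f : ℝ × ℝ³ → ℝ, one has sup_{(t,x) ∈ H̃_ρ} t^{3/2} |f(t,x)| ≤ C Σ_{|I| ≤ 2} (∫_{{|x| ≤ r(ρ)}} |(L^I f)(√(ρ² + |x|²), x)|² dx)^{1/2}, where L^I ranges over compositions of at most two boost vector fields Ω_{01}, Ω_{02}, Ω_{03}, and H̃_ρ = {(√(ρ² + |x|²), x) : |x| ≤ r(ρ)} with r(ρ) > 0 the unique positive solution of 2 r^{3/2} + r = ρ². -/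

import Mathlib

noncomputable section

open Real MeasureTheory

abbrev E3 : Type := EuclideanSpace ℝ (Fin 3)

/-- Time partial derivative `∂_t f`. -/
def dt (f : ℝ × E3 → ℝ) (p : ℝ × E3) : ℝ := fderiv ℝ f p (1, 0)

/-- Spatial partial derivative `∂_{x_i} f`. -/
def dx (i : Fin 3) (f : ℝ × E3 → ℝ) (p : ℝ × E3) : ℝ :=
  fderiv ℝ f p (0, EuclideanSpace.single i 1)

/-- Boost vector field `Ω_{0i} f = t ∂_{x_i} f + x_i ∂_t f`. -/
def boost (i : Fin 3) (f : ℝ × E3 → ℝ) (p : ℝ × E3) : ℝ :=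
  p.1 * dx i f p + p.2 i * dt f p

/-- The point of the hyperboloid `H_ρ` lying over `x ∈ ℝ³`. -/
def hLift (ρ : ℝ) (x : E3) : ℝ × E3 := (Real.sqrt (ρ ^ 2 + ‖x‖ ^ 2), x)

/-- The `L²` norm over the truncated hyperboloid `H̃_ρ = {(√(ρ²+|x|²), x) : |x| ≤ r(ρ)}`
with respect to the measure `dx`. -/
def L2T (ρ rρ : ℝ) (g : ℝ × E3 → ℝ) : ℝ :=
  Real.sqrt (∫ x in {x : E3 | ‖x‖ ≤ rρ}, (g (hLift ρ x)) ^ 2)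

open Set

/-- Second-order Taylor expansion at `1`, with the remainder controlled by a bound on `φ''`. -/
lemma abs_le_of_second_deriv_bound {φ φ' φ'' h : ℝ → ℝ}
    (hφ : ∀ s, HasDerivAt φ (φ' s) s) (hφ' : ∀ s, HasDerivAt φ' (φ'' s) s)
    (hh : Continuous h) (hb : ∀ s ∈ Ioo (0 : ℝ) 1, |φ'' s| ≤ h s) :
    |φ 0| ≤ |φ 1| + |φ' 1| + ∫ s in (0 : ℝ)..1, s * h s := by
  have hψ (s : ℝ) : HasDerivAt (fun s => s * φ' s - φ s) (s * φ'' s) s := by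
    refine (((hasDerivAt_id s).mul (hφ' s)).sub (hφ s)).congr_deriv ?_
    simp
  have hc : Continuous fun s => s * φ' s - φ s :=
    continuous_iff_continuousAt.2 fun s => (hψ s).continuousAt
  have hint : IntegrableOn (fun s => s * h s) (Icc 0 1) :=
    (continuous_id.mul hh).continuousOn.integrableOn_Icc
  have h1 := intervalIntegral.sub_le_integral_of_hasDeriv_right_of_le zero_le_one hc.continuousOn
    (fun s _ => (hψ s).hasDerivWithinAt) hint
    (fun s hs => mul_le_mul_of_nonneg_left ((abs_le.1 (hb s hs)).2) hs.1.le)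
  have h2 := intervalIntegral.sub_le_integral_of_hasDeriv_right_of_le zero_le_one
    hc.neg.continuousOn (fun s _ => (hψ s).neg.hasDerivWithinAt) hint
    (fun s hs => by
      have := mul_le_mul_of_nonneg_left ((abs_le.1 (hb s hs)).1) hs.1.le
      linarith)
  simp only [Pi.neg_apply] at h2
  rw [abs_le]
  constructor <;>
  linarith [le_abs_self (φ 1), neg_abs_le (φ 1), le_abs_self (φ' 1), neg_abs_le (φ' 1)]

/-- Cauchy–Schwarz against the constant function `1` on a compact set. -/
lemma setIntegral_le_sqrt_mul_sqrt {K : Set E3} (hK : IsCompact K) {u : E3 → ℝ}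
    (hu : Continuous u) :
    ∫ y in K, u y ≤ √(volume.real K) * √(∫ y in K, u y ^ 2) := by
  have hi : IntegrableOn u K := hu.continuousOn.integrableOn_compact hK
  have hi2 : IntegrableOn (fun y => u y ^ 2) K := (hu.pow 2).continuousOn.integrableOn_compact hK
  have : IsFiniteMeasure (volume.restrict K) := ⟨by simpa using hK.measure_lt_top⟩
  set V := volume.real K
  set I := ∫ y in K, u y
  set J := ∫ y in K, u y ^ 2
  rw [← Real.sqrt_mul measureReal_nonneg]
  apply Real.le_sqrt_of_sq_le
  rcases (measureReal_nonneg : 0 ≤ V).eq_or_lt with hV | hV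
  · have : I = 0 := by
      apply setIntegral_measure_zero
      exact (measureReal_eq_zero_iff hK.measure_lt_top.ne).1 hV.symm
    simp [this, ← hV]
  · have h0 : 0 ≤ ∫ y in K, (V * u y - I) ^ 2 := integral_nonneg fun y => sq_nonneg _
    have h1 : ∫ y in K, (V * u y - I) ^ 2 = V ^ 2 * J - 2 * V * I * I + V * I ^ 2 := by
      have : (fun y => (V * u y - I) ^ 2)
          = fun y => (V ^ 2 * u y ^ 2 - 2 * V * I * u y) + I ^ 2 := by
        ext y; ring
      rw [this, integral_add (by exact (hi2.const_mul _).sub (hi.const_mul _)) (integrable_const _),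
        integral_sub (hi2.const_mul _) (hi.const_mul _), integral_const_mul, integral_const_mul,
        setIntegral_const, smul_eq_mul]
    rw [h1] at h0
    have : 0 ≤ V * (V * J - I ^ 2) := by linarith
    linarith [nonneg_of_mul_nonneg_right this hV]

/-- Contracting a convex set towards one of its points by the factor `s` costs at most `s⁻³`. -/
lemma setIntegral_comp_contraction_le {K : Set E3} (hK : IsCompact K) (hconv : Convex ℝ K)
    {x : E3} (hx : x ∈ K) {u : E3 → ℝ} (hu : Continuous u) (hu0 : ∀ z, 0 ≤ u z)
    {s : ℝ} (hs0 : 0 < s) (hs1 : s ≤ 1) :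
    ∫ y in K, u (x + s • (y - x)) ≤ (s ^ 3)⁻¹ * ∫ z in K, u z := by
  have hKm : MeasurableSet K := hK.isClosed.measurableSet
  have hi : Integrable (K.indicator u) :=
    (hu.continuousOn.integrableOn_compact hK).integrable_indicator hKm
  have hT (y : E3) : x + s • (y - x) = (x - s • x) + s • y := by rw [smul_sub]; abel
  have hiT : Integrable fun y => K.indicator u (x + s • (y - x)) := by
    simp_rw [hT]
    exact (hi.comp_add_left (x - s • x)).comp_smul hs0.ne'
  have hle : ∫ y in K, u (x + s • (y - x)) ≤ ∫ y, K.indicator u (x + s • (y - x)) := by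
    rw [← integral_indicator hKm]
    refine integral_mono ?_ hiT fun y => ?_
    · have hc : Continuous fun y => u (x + s • (y - x)) := by fun_prop
      exact (hc.continuousOn.integrableOn_compact hK).integrable_indicator hKm
    · by_cases hy : y ∈ K
      · have : x + s • (y - x) ∈ K := hconv.add_smul_sub_mem hx hy ⟨hs0.le, hs1⟩
        simp [hy, this]
      · rw [indicator_of_notMem hy]
        exact indicator_nonneg (fun z _ => hu0 z) _
  refine hle.trans_eq ?_
  simp_rw [hT]
  rw [Measure.integral_comp_smul volume (fun y => K.indicator u (x - s • x + y)) s,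
    integral_add_left_eq_self, integral_indicator hKm, finrank_euclideanSpace_fin,
    abs_of_pos (by positivity), smul_eq_mul]

/-- An averaged second-order Taylor bound on a compact convex set gives a pointwise `L²` bound. -/
lemma mul_sqrt_volume_le_of_averaged_bound {K : Set E3} (hK : IsCompact K) (hconv : Convex ℝ K)
    (hV : 0 < volume.real K) {x : E3} (hx : x ∈ K) {H : E3 → ℝ} (hH : Continuous H) {a : ℝ}
    (ha : ∀ y ∈ K, a ≤ H y + ∫ s in (0 : ℝ)..1, s * H (x + s • (y - x))) :
    a * √(volume.real K) ≤ 3 * √(∫ z in K, H z ^ 2) := by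
  have hKm : MeasurableSet K := hK.isClosed.measurableSet
  have : IsFiniteMeasure (volume.restrict K) := ⟨by simpa using hK.measure_lt_top⟩
  set V := volume.real K
  set J := ∫ z in K, H z ^ 2
  have hcont : Continuous (Function.uncurry fun (s : ℝ) (y : E3) => s * H (x + s • (y - x))) := by
    unfold Function.uncurry; fun_prop
  have hcont' : Continuous (Function.uncurry fun (y : E3) (s : ℝ) => s * H (x + s • (y - x))) := by
    unfold Function.uncurry; fun_prop
  have hi : IntegrableOn H K := hH.continuousOn.integrableOn_compact hK
  have hi' : IntegrableOn (fun y => ∫ s in (0 : ℝ)..1, s * H (x + s • (y - x))) K :=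
    (intervalIntegral.continuous_parametric_intervalIntegral_of_continuous' hcont' 0
      1).continuousOn.integrableOn_compact hK
  have hprod : Integrable (Function.uncurry fun (s : ℝ) (y : E3) => s * H (x + s • (y - x)))
      ((volume.restrict (uIoc (0 : ℝ) 1)).prod (volume.restrict K)) := by
    rw [Measure.prod_restrict]
    refine IntegrableOn.mono_set (hcont.continuousOn.integrableOn_compact
      ((isCompact_Icc (a := (0 : ℝ)) (b := 1)).prod hK)) ?_
    rw [uIoc_of_le zero_le_one]
    exact prod_mono Ioc_subset_Icc_self le_rfl
  have h1 : V * a ≤ (∫ y in K, H y) + ∫ s in (0 : ℝ)..1, ∫ y in K, s * H (x + s • (y - x)) := by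
    rw [intervalIntegral_integral_swap hprod, ← integral_add hi hi']
    have := setIntegral_mono_on (integrable_const a) (hi.add hi') hKm ha
    rwa [setIntegral_const, smul_eq_mul] at this
  have h2 : ∫ s in (0 : ℝ)..1, ∫ y in K, s * H (x + s • (y - x)) ≤
      ∫ s in (0 : ℝ)..1, √V * √J * s ^ (-(1 / 2) : ℝ) := by
    refine intervalIntegral.integral_mono_on_of_le_Ioo zero_le_one ?_ ?_ fun s hs => ?_
    · exact (continuous_parametric_integral_of_continuous hcont hK).intervalIntegrable _ _
    · exact (intervalIntegral.intervalIntegrable_rpow' (by norm_num)).const_mul _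
    · have hs0 := hs.1
      have e : s ^ (-(1 / 2) : ℝ) = s * √((s ^ 3)⁻¹) := by
        rw [Real.rpow_neg hs0.le, ← Real.sqrt_eq_rpow, ← Real.sqrt_inv]
        nth_rewrite 2 [← Real.sqrt_sq hs0.le]
        rw [← Real.sqrt_mul (by positivity)]
        congr 1
        field_simp
      have hcs := setIntegral_le_sqrt_mul_sqrt hK
        (show Continuous fun y => H (x + s • (y - x)) by fun_prop)
      have hch := setIntegral_comp_contraction_le hK hconv hx (hH.pow 2)
        (fun z => sq_nonneg _) hs0 hs.2.le
      have hch' := Real.sqrt_le_sqrt hch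
      rw [Real.sqrt_mul (by positivity)] at hch'
      rw [integral_const_mul, e]
      calc s * ∫ y in K, H (x + s • (y - x)) ≤ s * (√V * (√((s ^ 3)⁻¹) * √J)) := by
            gcongr
            exact hcs.trans (mul_le_mul_of_nonneg_left hch' (Real.sqrt_nonneg _))
        _ = _ := by ring
  have h3 : ∫ s in (0 : ℝ)..1, √V * √J * s ^ (-(1 / 2) : ℝ) = 2 * (√V * √J) := by
    rw [intervalIntegral.integral_const_mul, integral_rpow (by norm_num)]
    norm_num
    ring
  have h4 := setIntegral_le_sqrt_mul_sqrt hK hH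
  have hVs : 0 < √V := Real.sqrt_pos.2 hV
  have hVV : √V * √V = V := Real.mul_self_sqrt hV.le
  refine le_of_mul_le_mul_left (a := √V) ?_ hVs
  have : √V * (a * √V) = V * a := by linear_combination a * hVV
  rw [this]
  linarith

lemma le_hLift_fst (ρ : ℝ) (z : E3) : ‖z‖ ≤ (hLift ρ z).1 :=
  Real.le_sqrt_of_sq_le (by nlinarith [sq_nonneg ρ])

lemma hLift_fst_pos {ρ : ℝ} (hρ : 0 < ρ) (z : E3) : 0 < (hLift ρ z).1 :=
  Real.sqrt_pos.2 (by positivity)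

lemma hLift_fst_sq (ρ : ℝ) (z : E3) : (hLift ρ z).1 ^ 2 = ρ ^ 2 + ‖z‖ ^ 2 :=
  Real.sq_sqrt (by positivity)

lemma hLift_fst_le_add (ρ : ℝ) (x z : E3) : (hLift ρ x).1 ≤ (hLift ρ z).1 + ‖z - x‖ := by
  have h0 : 0 ≤ (hLift ρ z).1 := Real.sqrt_nonneg _
  refine Real.sqrt_le_iff.2 ⟨by positivity, ?_⟩
  have h1 : ‖x‖ ≤ ‖z‖ + ‖z - x‖ := by
    simpa using norm_sub_le z (z - x)
  nlinarith [hLift_fst_sq ρ z, le_hLift_fst ρ z, norm_nonneg x, norm_nonneg z,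
    norm_nonneg (z - x), mul_le_mul_of_nonneg_right (le_hLift_fst ρ z) (norm_nonneg (z - x)),
    mul_self_le_mul_self (norm_nonneg x) h1]

lemma continuous_hLift (ρ : ℝ) : Continuous (hLift ρ) := by
  unfold hLift; fun_prop

lemma contDiff_boost {m n : WithTop ℕ∞} (hmn : m + 1 ≤ n) (i : Fin 3) {f : ℝ × E3 → ℝ}
    (hf : ContDiff ℝ n f) : ContDiff ℝ m (boost i f) := by
  have h : ContDiff ℝ m (fderiv ℝ f) := hf.fderiv_right hmn
  unfold boost dx dt
  fun_prop

lemma hasDerivAt_hLift_fst_line {ρ : ℝ} (hρ : 0 < ρ) (x v : E3) (s : ℝ) :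
    HasDerivAt (fun s : ℝ => (hLift ρ (x + s • v)).1)
      (inner ℝ (x + s • v) v / (hLift ρ (x + s • v)).1) s := by
  have hc : HasDerivAt (fun s : ℝ => x + s • v) v s := by
    simpa using ((hasDerivAt_id s).smul_const v).const_add x
  refine ((hc.norm_sq.const_add (ρ ^ 2)).sqrt (by positivity)).congr_deriv ?_
  simp only [hLift]
  field_simp

/-- The derivative of `F` along the lift of a line is a combination of boosts. -/
lemma hasDerivAt_comp_hLift_line {ρ : ℝ} (hρ : 0 < ρ) {F : ℝ × E3 → ℝ} (hF : Differentiable ℝ F)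
    (x v : E3) (s : ℝ) :
    HasDerivAt (fun s : ℝ => F (hLift ρ (x + s • v)))
      (∑ i, v i * (boost i F (hLift ρ (x + s • v)) / (hLift ρ (x + s • v)).1)) s := by
  have hc : HasDerivAt (fun s : ℝ => x + s • v) v s := by
    simpa using ((hasDerivAt_id s).smul_const v).const_add x
  have hp : HasDerivAt (fun s : ℝ => hLift ρ (x + s • v)) _ s :=
    (hasDerivAt_hLift_fst_line hρ x v s).prodMk hc
  refine ((hF _).hasFDerivAt.comp_hasDerivAt s hp).congr_deriv ?_
  have hw := hLift_fst_pos hρ (x + s • v)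
  set z := x + s • v
  have hdec : (inner ℝ z v / (hLift ρ z).1, v) = (inner ℝ z v / (hLift ρ z).1) • ((1 : ℝ), (0 : E3))
      + ∑ i, v i • ((0 : ℝ), (EuclideanSpace.single i (1 : ℝ) : E3)) := by
    ext j
    · simp [Fin.sum_univ_three]
    · simp [Fin.sum_univ_three]
      fin_cases j <;> simp
  rw [hdec, map_add, map_sum]
  simp only [map_smul, smul_eq_mul, boost, dx, dt]
  rw [PiLp.inner_apply]
  simp only [Fin.sum_univ_three, RCLike.inner_apply, conj_trivial]
  have : (hLift ρ z).2 = z := rfl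
  rw [this]
  field_simp
  ring

/-- The sum of the absolute values of all boost derivatives of `f` of order at most two. -/
def boostSum (ρ : ℝ) (f : ℝ × E3 → ℝ) (z : E3) : ℝ :=
  |f (hLift ρ z)| + (∑ i, |boost i f (hLift ρ z)|)
    + ∑ i, ∑ j, |boost i (boost j f) (hLift ρ z)|

lemma continuous_boost_hLift {f : ℝ × E3 → ℝ} (hf : ContDiff ℝ 2 f) (ρ : ℝ) (i : Fin 3) :
    Continuous fun z => boost i f (hLift ρ z) :=
  (contDiff_boost (m := 1) (by norm_num) i hf).continuous.comp (continuous_hLift ρ)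

lemma continuous_boost_boost_hLift {f : ℝ × E3 → ℝ} (hf : ContDiff ℝ 2 f) (ρ : ℝ) (i j : Fin 3) :
    Continuous fun z => boost i (boost j f) (hLift ρ z) :=
  (contDiff_boost (m := 0) (n := 1) (by norm_num) i
    (contDiff_boost (by norm_num) j hf)).continuous.comp (continuous_hLift ρ)

lemma continuous_boostSum {f : ℝ × E3 → ℝ} (hf : ContDiff ℝ 2 f) (ρ : ℝ) :
    Continuous (boostSum ρ f) := by
  have h0 : Continuous fun z => f (hLift ρ z) := hf.continuous.comp (continuous_hLift ρ)
  have h1 := continuous_boost_hLift hf ρ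
  have h2 := continuous_boost_boost_hLift hf ρ
  unfold boostSum
  exact (h0.abs.add (continuous_finsetSum _ fun i _ => (h1 i).abs)).add
    (continuous_finsetSum _ fun i _ => continuous_finsetSum _ fun j _ => (h2 i j).abs)

lemma abs_le_boostSum_add_integral {ρ : ℝ} (hρ : 0 < ρ) {f : ℝ × E3 → ℝ} (hf : ContDiff ℝ 2 f)
    {x y : E3} (hxy : 2 * ‖y - x‖ ≤ (hLift ρ x).1) :
    |f (hLift ρ x)| ≤
      boostSum ρ f y + ∫ s in (0 : ℝ)..1, s * boostSum ρ f (x + s • (y - x)) := by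
  set v := y - x with hv
  have hf1 : Differentiable ℝ f := hf.differentiable (by norm_num)
  have hB (i : Fin 3) : Differentiable ℝ (boost i f) :=
    (contDiff_boost (m := 1) (by norm_num) i hf).differentiable (by norm_num)
  have hvw (s : ℝ) (hs : s ∈ Icc (0 : ℝ) 1) : ‖v‖ ≤ (hLift ρ (x + s • v)).1 := by
    have h := hLift_fst_le_add ρ x (x + s • v)
    rw [add_sub_cancel_left, norm_smul, Real.norm_of_nonneg hs.1] at h
    nlinarith [norm_nonneg v, hs.2]
  have hvi (s : ℝ) (hs : s ∈ Icc (0 : ℝ) 1) (i : Fin 3) : |v i / (hLift ρ (x + s • v)).1| ≤ 1 := by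
    have hw := hLift_fst_pos hρ (x + s • v)
    rw [abs_div, abs_of_pos hw, div_le_one hw]
    exact (PiLp.norm_apply_le v i).trans (hvw s hs)
  have hd2 (s : ℝ) := HasDerivAt.fun_sum (u := Finset.univ) fun (i : Fin 3) _ =>
    ((hasDerivAt_comp_hLift_line hρ (hB i) x v s).div (hasDerivAt_hLift_fst_line hρ x v s)
      (hLift_fst_pos hρ (x + s • v)).ne').const_mul (v i)
  have key := abs_le_of_second_deriv_bound
    (fun s => hasDerivAt_comp_hLift_line hρ hf1 x v s) hd2
    (h := fun s => boostSum ρ f (x + s • v)) ((continuous_boostSum hf ρ).comp (by fun_prop)) ?_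
  · have e1 : x + (1 : ℝ) • v = y := by simp [hv]
    simp only [zero_smul, add_zero] at key
    refine key.trans (add_le_add_left ?_ _)
    have h1 : |∑ i, v i * (boost i f (hLift ρ (x + (1 : ℝ) • v)) / (hLift ρ (x + (1 : ℝ) • v)).1)|
        ≤ ∑ i, |boost i f (hLift ρ (x + (1 : ℝ) • v))| := by
      refine (Finset.abs_sum_le_sum_abs _ _).trans (Finset.sum_le_sum fun i _ => ?_)
      rw [mul_div_left_comm, abs_mul]
      exact mul_le_of_le_one_right (abs_nonneg _) (hvi 1 (by simp) i)
    rw [e1] at h1 ⊢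
    have h2 : 0 ≤ ∑ i, ∑ j, |boost i (boost j f) (hLift ρ y)| := by positivity
    unfold boostSum
    linarith
  · intro s hs
    have hs' := Ioo_subset_Icc_self hs
    have hw := hLift_fst_pos hρ (x + s • v)
    have hin : |inner ℝ (x + s • v) v / (hLift ρ (x + s • v)).1 ^ 2| ≤ 1 := by
      rw [abs_div, abs_of_pos (pow_pos hw 2), div_le_one (pow_pos hw 2), sq]
      exact (abs_real_inner_le_norm _ _).trans
        (mul_le_mul (le_hLift_fst _ _) (hvw s hs') (norm_nonneg _) hw.le)
    replace hvi := hvi s hs'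
    set p := hLift ρ (x + s • v)
    have hsplit : (∑ i, v i * (((∑ j, v j * (boost j (boost i f) p / p.1)) * p.1
          - boost i f p * (inner ℝ (x + s • v) v / p.1)) / p.1 ^ 2))
        = (∑ i, ∑ j, (v i / p.1) * (v j / p.1) * boost j (boost i f) p)
          - ∑ i, (v i / p.1) * (inner ℝ (x + s • v) v / p.1 ^ 2) * boost i f p := by
      rw [← Finset.sum_sub_distrib]
      refine Finset.sum_congr rfl fun i _ => ?_
      simp only [Fin.sum_univ_three]
      field_simp
    rw [hsplit, Finset.sum_comm]
    have hmul {a b c : ℝ} (ha : |a| ≤ 1) (hb : |b| ≤ 1) : |a * b * c| ≤ |c| := by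
      rw [abs_mul, abs_mul]
      exact mul_le_of_le_one_left (abs_nonneg _) (mul_le_one₀ ha (abs_nonneg _) hb)
    have h2 : |∑ j, ∑ i, (v i / p.1) * (v j / p.1) * boost j (boost i f) p|
        ≤ ∑ j, ∑ i, |boost j (boost i f) p| :=
      (Finset.abs_sum_le_sum_abs _ _).trans <| Finset.sum_le_sum fun j _ =>
        (Finset.abs_sum_le_sum_abs _ _).trans <| Finset.sum_le_sum fun i _ => hmul (hvi i) (hvi j)
    have h1 : |∑ i, (v i / p.1) * (inner ℝ (x + s • v) v / p.1 ^ 2) * boost i f p|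
        ≤ ∑ i, |boost i f p| :=
      (Finset.abs_sum_le_sum_abs _ _).trans <| Finset.sum_le_sum fun i _ => hmul (hvi i) hin
    refine (abs_sub _ _).trans ?_
    have h0 := abs_nonneg (f p)
    unfold boostSum
    linarith

lemma sqrt_setIntegral_boostSum_sq_le {ρ R : ℝ} {f : ℝ × E3 → ℝ} (hf : ContDiff ℝ 2 f)
    {K : Set E3} (hKR : K ⊆ {x : E3 | ‖x‖ ≤ R}) :
    √(∫ z in K, boostSum ρ f z ^ 2) ≤ 6 * (L2T ρ R f + (∑ i : Fin 3, L2T ρ R (boost i f))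
            + ∑ i : Fin 3, ∑ j : Fin 3, L2T ρ R (boost i (boost j f))) := by
  have hBall : IsCompact {x : E3 | ‖x‖ ≤ R} := by
    simpa [Metric.closedBall, dist_zero_right] using isCompact_closedBall (0 : E3) R
  have hm : MeasurableSet {x : E3 | ‖x‖ ≤ R} := hBall.isClosed.measurableSet
  have hint {u : E3 → ℝ} (hu : Continuous u) :
      IntegrableOn (fun z => u z ^ 2) {x : E3 | ‖x‖ ≤ R} :=
    (hu.pow 2).continuousOn.integrableOn_compact hBall
  have i0 : IntegrableOn (fun z => f (hLift ρ z) ^ 2) {x : E3 | ‖x‖ ≤ R} :=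
    hint (hf.continuous.comp (continuous_hLift ρ))
  have i1 (i : Fin 3) := hint (continuous_boost_hLift hf ρ i)
  have i2 (i j : Fin 3) := hint (continuous_boost_boost_hLift hf ρ i j)
  have j1 : IntegrableOn (fun z => ∑ i, boost i f (hLift ρ z) ^ 2) {x : E3 | ‖x‖ ≤ R} :=
    integrable_finsetSum _ fun i _ => i1 i
  have j2 : IntegrableOn (fun z => ∑ i, ∑ j, boost i (boost j f) (hLift ρ z) ^ 2)
      {x : E3 | ‖x‖ ≤ R} :=
    integrable_finsetSum _ fun i _ => integrable_finsetSum _ fun j _ => i2 i j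
  have hL (g : ℝ × E3 → ℝ) :
      ∫ z in {x : E3 | ‖x‖ ≤ R}, g (hLift ρ z) ^ 2 = L2T ρ R g ^ 2 :=
    (Real.sq_sqrt (integral_nonneg fun z => sq_nonneg _)).symm
  have hL0 (g : ℝ × E3 → ℝ) : 0 ≤ L2T ρ R g := Real.sqrt_nonneg _
  refine Real.sqrt_le_iff.2 ⟨?_, ?_⟩
  · have := hL0 f
    have := Finset.sum_nonneg fun i (_ : i ∈ Finset.univ) => hL0 (boost i f)
    have := Finset.sum_nonneg fun i (_ : i ∈ Finset.univ) =>
      Finset.sum_nonneg fun j (_ : j ∈ Finset.univ) => hL0 (boost i (boost j f))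
    linarith
  have hpt (z : E3) : boostSum ρ f z ^ 2 ≤ 36 * (f (hLift ρ z) ^ 2
      + (∑ i, boost i f (hLift ρ z) ^ 2) + ∑ i, ∑ j, boost i (boost j f) (hLift ρ z) ^ 2) := by
    have s1 := sq_sum_le_card_mul_sum_sq (s := Finset.univ)
      (f := fun i : Fin 3 => |boost i f (hLift ρ z)|)
    have s2 := sq_sum_le_card_mul_sum_sq (s := Finset.univ)
      (f := fun i : Fin 3 => ∑ j, |boost i (boost j f) (hLift ρ z)|)
    have s3 := Finset.sum_le_sum fun i (_ : i ∈ Finset.univ) =>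
      sq_sum_le_card_mul_sum_sq (s := Finset.univ)
        (f := fun j : Fin 3 => |boost i (boost j f) (hLift ρ z)|)
    simp only [Finset.card_univ, Fintype.card_fin, Nat.cast_ofNat, sq_abs,
      ← Finset.mul_sum] at s1 s2 s3
    have p0 := sq_abs (f (hLift ρ z))
    have p0' := sq_nonneg (f (hLift ρ z))
    have p1 : 0 ≤ ∑ i, boost i f (hLift ρ z) ^ 2 := by positivity
    have p2 : 0 ≤ ∑ i, ∑ j, boost i (boost j f) (hLift ρ z) ^ 2 := by positivity
    unfold boostSum
    set A := |f (hLift ρ z)|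
    set B := ∑ i, |boost i f (hLift ρ z)|
    set D := ∑ i, ∑ j, |boost i (boost j f) (hLift ρ z)|
    nlinarith [sq_nonneg (A - B), sq_nonneg (A - D), sq_nonneg (B - D)]
  calc ∫ z in K, boostSum ρ f z ^ 2
      ≤ ∫ z in {x : E3 | ‖x‖ ≤ R}, boostSum ρ f z ^ 2 :=
        setIntegral_mono_set (hint (continuous_boostSum hf ρ))
          (ae_of_all _ fun z => sq_nonneg _) hKR.eventuallyLE
    _ ≤ ∫ z in {x : E3 | ‖x‖ ≤ R}, 36 * (f (hLift ρ z) ^ 2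
          + (∑ i, boost i f (hLift ρ z) ^ 2)
          + ∑ i, ∑ j, boost i (boost j f) (hLift ρ z) ^ 2) :=
        setIntegral_mono_on (hint (continuous_boostSum hf ρ))
          (by exact ((i0.add j1).add j2).const_mul 36) hm fun z _ => hpt z
    _ = 36 * (L2T ρ R f ^ 2 + (∑ i, L2T ρ R (boost i f) ^ 2)
          + ∑ i, ∑ j, L2T ρ R (boost i (boost j f)) ^ 2) := by
        rw [integral_const_mul, integral_add (by exact i0.add j1) j2, integral_add i0 j1,
          integral_finsetSum _ fun i _ => i1 i,
          integral_finsetSum _ fun i _ => integrable_finsetSum _ fun j _ => i2 i j]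
        simp_rw [integral_finsetSum _ fun j _ => i2 _ j, hL]
    _ ≤ _ := by
        have q1 := Finset.sum_sq_le_sq_sum_of_nonneg (s := Finset.univ)
          fun i (_ : i ∈ Finset.univ) => hL0 (boost i f)
        have q2 := Finset.sum_sq_le_sq_sum_of_nonneg (s := Finset.univ)
          fun i (_ : i ∈ Finset.univ) => Finset.sum_nonneg fun j (_ : j ∈ Finset.univ) =>
            hL0 (boost i (boost j f))
        have q3 := Finset.sum_le_sum fun i (_ : i ∈ Finset.univ) =>
          Finset.sum_sq_le_sq_sum_of_nonneg (s := Finset.univ)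
            fun j (_ : j ∈ Finset.univ) => hL0 (boost i (boost j f))
        have p1 := Finset.sum_nonneg fun i (_ : i ∈ Finset.univ) => hL0 (boost i f)
        have p2 := Finset.sum_nonneg fun i (_ : i ∈ Finset.univ) =>
          Finset.sum_nonneg fun j (_ : j ∈ Finset.univ) => hL0 (boost i (boost j f))
        nlinarith [mul_nonneg (hL0 f) p1, mul_nonneg (hL0 f) p2, mul_nonneg p1 p2]

/-- Klainerman–Sobolev inequality on truncated hyperboloids. -/
theorem klainerman_sobolev_truncated :
    ∃ C > (0 : ℝ), ∀ ρ rρ : ℝ, 2 ≤ ρ → 0 < rρ →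
      2 * rρ ^ ((3 : ℝ) / 2) + rρ = ρ ^ 2 →
      ∀ f : ℝ × E3 → ℝ, ContDiff ℝ 2 f →
      ∀ x : E3, ‖x‖ ≤ rρ →
        (hLift ρ x).1 ^ ((3 : ℝ) / 2) * |f (hLift ρ x)| ≤
          C * (L2T ρ rρ f + (∑ i : Fin 3, L2T ρ rρ (boost i f))
            + ∑ i : Fin 3, ∑ j : Fin 3, L2T ρ rρ (boost i (boost j f))) := by
  set κ := volume.real (Metric.ball (0 : E3) 1)
  have hκ : 0 < κ := ENNReal.toReal_pos (Metric.measure_ball_pos _ _ one_pos).ne'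
    measure_ball_lt_top.ne
  refine ⟨144 / √κ, by positivity, fun ρ R hρ hR hRρ f hf x hx => ?_⟩
  have hρ0 : 0 < ρ := by linarith
  set w := (hLift ρ x).1
  have hw : 0 < w := hLift_fst_pos hρ0 x
  have hR1 : 1 ≤ R := by
    by_contra! h
    have := Real.rpow_le_one hR.le h.le (show (0 : ℝ) ≤ 3 / 2 by norm_num)
    nlinarith
  have hwR : w ≤ 2 * R := by
    have h1 : R ^ ((3 : ℝ) / 2) ≤ R ^ (2 : ℝ) := Real.rpow_le_rpow_of_exponent_le hR1 (by norm_num)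
    rw [Real.rpow_two] at h1
    refine Real.sqrt_le_iff.2 ⟨by positivity, ?_⟩
    nlinarith [norm_nonneg x]
  set δ := w / 4 with hδ
  have hδ0 : 0 < δ := by positivity
  set c := (1 - δ / R) • x with hc
  have hδR : δ / R ≤ 1 := (div_le_one hR).2 (by linarith)
  have hxc : dist x c ≤ δ := by
    have : x - c = (δ / R) • x := by rw [hc, sub_smul, one_smul]; abel
    rw [dist_eq_norm, this, norm_smul, Real.norm_of_nonneg (by positivity), div_mul_eq_mul_div,
      div_le_iff₀ hR]
    gcongr
  have hKR : Metric.closedBall c δ ⊆ {x : E3 | ‖x‖ ≤ R} := fun y hy => by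
    have h1 : ‖c‖ ≤ R - δ := by
      rw [hc, norm_smul, Real.norm_of_nonneg (by linarith)]
      calc (1 - δ / R) * ‖x‖ ≤ (1 - δ / R) * R := by gcongr
        _ = R - δ := by field_simp
    have h2 : ‖y‖ ≤ ‖c‖ + dist y c := by
      rw [dist_eq_norm]; simpa using norm_add_le c (y - c)
    exact h2.trans (by linarith [Metric.mem_closedBall.1 hy])
  have hvol : volume.real (Metric.closedBall c δ) = δ ^ 3 * κ := by
    rw [Measure.addHaar_real_closedBall _ _ hδ0.le, finrank_euclideanSpace_fin]
  have h1 := mul_sqrt_volume_le_of_averaged_bound (isCompact_closedBall c δ)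
    (convex_closedBall c δ) (by rw [hvol]; positivity) (Metric.mem_closedBall.2 hxc)
    (continuous_boostSum hf ρ) fun y hy => abs_le_boostSum_add_integral hρ0 hf (x := x) <| by
      rw [← dist_eq_norm]
      linarith [dist_triangle_right y x c, Metric.mem_closedBall.1 hy]
  have h2 := sqrt_setIntegral_boostSum_sq_le (ρ := ρ) hf hKR
  have e : √(δ ^ 3 * κ) = w ^ ((3 : ℝ) / 2) / 8 * √κ := by
    rw [Real.sqrt_mul (by positivity), hδ]
    congr 1
    rw [Real.sqrt_eq_iff_mul_self_eq_of_pos (by positivity), div_mul_div_comm,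
      ← Real.rpow_add hw]
    norm_num
    ring
  rw [hvol, e] at h1
  rw [div_mul_eq_mul_div, le_div_iff₀ (Real.sqrt_pos.2 hκ)]
  linarith
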